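/- Let N ≥ 2 and let {(𝒮_n, W_n)}_{n=1}^∞ be a sequence of quadratures, with 𝒮_n = (u_i^n)_{i=1}^{I_n} and W_n = (w_i^n)_{i=1}^{I_n}, such that {(u_i^n, w_i^n)}_{i=1}^{I_n} is an ε_n-accurate quadrature and such that ε_n → 0 and δ_n = disp(𝒮_n) → 0, with ε_n, δ_n ≤ 1/(10√N) for all n. Write 𝒟^γ_n for 𝒟^γ relative to (𝒮_n, W_n) and set γ_n = 16√N ‖C‖_∞ (2ε_n + δ_n) + L_C δ_n. Then: (i) d_{HH}(𝒟^{γ_n}_n, 𝒞^0) → 0 as n → ∞; (ii) max_{𝓑 ∈ 𝒟^0_n} min_{𝓑' ∈ 𝒞^0} d_H(𝓑,𝓑') → 0 as n → ∞; and (iii) if 𝒞^0 = {𝓑^CP} is a singleton, then d_{HH}(𝒟^0_n, 𝒞^0) → 0 as n → ∞. -/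

import Mathlib

open MeasureTheory Metric Set TopologicalSpace Filter
open scoped RealInnerProductSpace NNReal ENNReal

noncomputable section

abbrev Euc (N : ℕ) := EuclideanSpace ℝ (Fin N)

/-- The outreach (support) function of a set. -/
def outreach {N : ℕ} (B : Set (Euc N)) (u : Euc N) : ℝ :=
  sSup ((fun b => ⟪b, u⟫) '' B)

/-- The half-space `Π⁻(u,b)`. -/
def halfSpace {N : ℕ} (u : Euc N) (b : ℝ) : Set (Euc N) := {x | ⟪u, x⟫ ≤ b}

/-- The uniform probability measure on the unit sphere. -/
def sphereMeasure (N : ℕ) : Measure (Metric.sphere (0 : Euc N) 1) :=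
  (((volume : Measure (Euc N)).toSphere) Set.univ)⁻¹ • ((volume : Measure (Euc N)).toSphere)

/-- The sup-norm of a function restricted to the unit sphere. -/
def supNormSphere {N : ℕ} (f : Euc N → ℝ) : ℝ :=
  ⨆ x : Metric.sphere (0 : Euc N) 1, |f x|

/-- The dispersion of a set of directions. -/
def dispersion {N : ℕ} (S : Set (Euc N)) : ℝ :=
  ⨆ u : Metric.sphere (0 : Euc N) 1, ⨅ v : S, ‖(u : Euc N) - (v : Euc N)‖

/-- `ε`-accurate quadrature on the unit sphere. -/
def IsAccurateQuadrature {N : ℕ} {ι : Type*} [Fintype ι]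
    (u : ι → Euc N) (w : ι → ℝ) (ε : ℝ) : Prop :=
  (∀ i, u i ∈ Metric.sphere (0 : Euc N) 1) ∧ (∀ i, 0 ≤ w i) ∧
  ∀ (L : ℝ≥0) (f : Euc N → ℝ), LipschitzOnWith L f (Metric.sphere (0 : Euc N) 1) →
    |(∫ x : Metric.sphere (0 : Euc N) 1, f x ∂(sphereMeasure N)) - ∑ i, w i * f (u i)|
      ≤ ε * (L + supNormSphere f)

/-- Halved mean width. -/
def meanHalfWidth {N : ℕ} (B : Set (Euc N)) : ℝ :=
  ∫ u : Metric.sphere (0 : Euc N) 1, outreach B (u : Euc N) ∂(sphereMeasure N)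

/-- Feasible solutions of the continuous problem. -/
def CInf {N : ℕ} (C : Euc N → ℝ) : Set (Set (Euc N)) :=
  {B | B.Nonempty ∧ Convex ℝ B ∧ IsCompact B ∧
    ∀ u ∈ Metric.sphere (0 : Euc N) 1, C u ≤ outreach B u}

/-- Optimal value of the continuous problem. -/
def VCP {N : ℕ} (C : Euc N → ℝ) : ℝ := sInf (meanHalfWidth '' CInf C)

/-- `γ`-near optimal solutions of the continuous problem. -/
def CGamma {N : ℕ} (C : Euc N → ℝ) (γ : ℝ) : Set (Set (Euc N)) :=
  {B ∈ CInf C | meanHalfWidth B - VCP C ≤ γ}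

/-- Feasible solutions of the discrete problem with node set `S`. -/
def DInf {N : ℕ} (C : Euc N → ℝ) (S : Set (Euc N)) : Set (Set (Euc N)) :=
  {B | B.Nonempty ∧ Convex ℝ B ∧ IsCompact B ∧ ∀ u ∈ S, C u ≤ outreach B u}

/-- Discrete objective. -/
def quadSum {N : ℕ} {ι : Type*} [Fintype ι] (u : ι → Euc N) (w : ι → ℝ)
    (B : Set (Euc N)) : ℝ :=
  ∑ i, w i * outreach B (u i)

/-- Optimal value of the discrete problem. -/
def VDP {N : ℕ} {ι : Type*} [Fintype ι] (u : ι → Euc N) (w : ι → ℝ) (C : Euc N → ℝ) : ℝ :=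
  sInf (quadSum u w '' DInf C (Set.range u))

/-- `γ`-near optimal solutions of the discrete problem. -/
def DGamma {N : ℕ} {ι : Type*} [Fintype ι] (u : ι → Euc N) (w : ι → ℝ) (C : Euc N → ℝ)
    (γ : ℝ) : Set (Set (Euc N)) :=
  {B ∈ DInf C (Set.range u) | quadSum u w B - VDP u w C ≤ γ}

abbrev Sph (N : ℕ) := Metric.sphere (0 : Euc N) 1

lemma sphereMeasure_prob {N : ℕ} (hN : 2 ≤ N) : IsProbabilityMeasure (sphereMeasure N) := by
  have : Nonempty (Fin N) := ⟨⟨0, by omega⟩⟩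
  constructor
  rw [sphereMeasure, Measure.smul_apply, smul_eq_mul]
  refine ENNReal.inv_mul_cancel ?_ (measure_ne_top _ _)
  rw [Measure.measure_univ_ne_zero]
  exact Measure.toSphere_ne_zero _

/-- Action of a linear isometry on the sphere. -/
def sphMap {N : ℕ} (A : Euc N ≃ₗᵢ[ℝ] Euc N) (x : Sph N) : Sph N :=
  ⟨A x, by simp⟩

lemma continuous_sphMap {N : ℕ} (A : Euc N ≃ₗᵢ[ℝ] Euc N) : Continuous (sphMap A) := by
  unfold sphMap
  exact Continuous.subtype_mk (A.continuous.comp continuous_subtype_val) _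

open scoped Pointwise in
lemma sphMap_mp {N : ℕ} (A : Euc N ≃ₗᵢ[ℝ] Euc N) :
    MeasurePreserving (sphMap A) (sphereMeasure N) (sphereMeasure N) := by
  have key : MeasurePreserving (sphMap A) ((volume : Measure (Euc N)).toSphere)
      ((volume : Measure (Euc N)).toSphere) := by
    refine ⟨(continuous_sphMap A).measurable, ?_⟩
    ext s hs
    rw [Measure.map_apply (continuous_sphMap A).measurable hs,
      Measure.toSphere_apply' _ hs,
      Measure.toSphere_apply' _ ((continuous_sphMap A).measurable hs)]
    congr 1
    have : (Ioo (0:ℝ) 1 • ((↑) '' (sphMap A ⁻¹' s)) : Set (Euc N))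
        = A ⁻¹' (Ioo (0:ℝ) 1 • ((↑) '' s)) := by
      ext x
      simp only [Set.mem_smul, Set.mem_preimage, Set.mem_image]
      constructor
      · rintro ⟨r, hr, y, ⟨z, hz, rfl⟩, rfl⟩
        exact ⟨r, hr, A z, ⟨sphMap A z, hz, rfl⟩, by simp⟩
      · rintro ⟨r, hr, y, ⟨z, hz, rfl⟩, h⟩
        refine ⟨r, hr, A.symm z, ⟨sphMap A.symm z, ?_, rfl⟩, ?_⟩
        · have : sphMap A (sphMap A.symm z) = z := by
            apply Subtype.ext; simp [sphMap]
          rw [this]; exact hz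
        · apply A.injective
          simp [← h]
    rw [this]
    exact A.measurePreserving.measure_preimage_equiv (f := A.toMeasurableEquiv) _
  unfold sphereMeasure
  exact ⟨key.measurable, by rw [Measure.map_smul, key.map_eq]⟩

lemma sph_integrable {N : ℕ} (hN : 2 ≤ N) {f : Sph N → ℝ} (hf : Continuous f) :
    Integrable f (sphereMeasure N) := by
  have := sphereMeasure_prob hN
  have : CompactSpace (Sph N) := isCompact_iff_compactSpace.mp (isCompact_sphere _ _)
  exact hf.integrable_of_hasCompactSupport (HasCompactSupport.of_compactSpace f)

lemma sph_rot {N : ℕ} (g : ℝ → ℝ) {v v' : Euc N} (h : ‖v‖ = ‖v'‖) :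
    ∫ x : Sph N, g ⟪v, (x : Euc N)⟫ ∂(sphereMeasure N)
      = ∫ x : Sph N, g ⟪v', (x : Euc N)⟫ ∂(sphereMeasure N) := by
  set A := Submodule.reflection (Submodule.span ℝ {v - v'})ᗮ with hA
  have hAv : A v = v' := Submodule.reflection_sub h
  have emb : MeasurableEmbedding (sphMap A) := by
    have : CompactSpace (Sph N) := isCompact_iff_compactSpace.mp (isCompact_sphere _ _)
    refine Topology.IsClosedEmbedding.measurableEmbedding ?_
    refine (continuous_sphMap A).isClosedEmbedding ?_
    intro x y hxy
    apply Subtype.ext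
    apply A.injective
    exact congrArg Subtype.val hxy
  rw [← (sphMap_mp A).integral_comp emb (fun x : Sph N => g ⟪v', (x : Euc N)⟫)]
  congr 1
  ext x
  rw [← hAv]
  simp [sphMap]

/-- moments -/
lemma sph_m2 {N : ℕ} (hN : 2 ≤ N) (v : Euc N) :
    (N : ℝ) * ∫ x : Sph N, ⟪v, (x : Euc N)⟫ ^ 2 ∂(sphereMeasure N) = ‖v‖ ^ 2 := by
  have := sphereMeasure_prob hN
  have h1 : ∀ i : Fin N, ∫ x : Sph N, ⟪v, (x : Euc N)⟫ ^ 2 ∂(sphereMeasure N)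
      = ∫ x : Sph N, (‖v‖ * (x : Euc N) i) ^ 2 ∂(sphereMeasure N) := by
    intro i
    rw [sph_rot (fun t => t ^ 2) (v := v) (v' := ‖v‖ • EuclideanSpace.single i 1) (by simp [norm_smul])]
    simp [inner_smul_left, EuclideanSpace.inner_single_left]
  have h2 : ∑ i : Fin N, ∫ x : Sph N, (‖v‖ * (x : Euc N) i) ^ 2 ∂(sphereMeasure N) = ‖v‖ ^ 2 := by
    rw [← integral_finsetSum _ (fun i _ => sph_integrable hN (by fun_prop))]
    have : ∀ x : Sph N, ∑ i : Fin N, (‖v‖ * (x : Euc N) i) ^ 2 = ‖v‖ ^ 2 := by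
      intro x
      have hx : ∑ i, (x : Euc N) i ^ 2 = 1 := by
        rw [← EuclideanSpace.real_norm_sq_eq]; simp
      simp_rw [mul_pow, ← Finset.mul_sum, hx, mul_one]
    simp [this]
  rw [← h2, Finset.sum_congr rfl (fun i _ => (h1 i).symm)]
  simp

lemma sph_m4 {N : ℕ} (hN : 2 ≤ N) (v : Euc N) (hv : ‖v‖ = 1) :
    (N : ℝ) * (N + 2) * ∫ x : Sph N, ⟪v, (x : Euc N)⟫ ^ 4 ∂(sphereMeasure N) = 3 := by
  have := sphereMeasure_prob hN
  set m := ∫ x : Sph N, ⟪v, (x : Euc N)⟫ ^ 4 ∂(sphereMeasure N) with hm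
  have g : ∀ v' : Euc N, ∫ x : Sph N, ⟪v', (x : Euc N)⟫ ^ 4 ∂(sphereMeasure N) = ‖v'‖ ^ 4 * m := by
    intro v'
    rw [sph_rot (fun t => t ^ 4) (v := v') (v' := ‖v'‖ • v) (by simp [norm_smul, hv])]
    simp only [inner_smul_left, mul_pow, integral_const_mul]
    simp [hm]
  have e1 : ∀ i : Fin N, ∫ x : Sph N, (x : Euc N) i ^ 4 ∂(sphereMeasure N) = m := by
    intro i
    have := g (EuclideanSpace.single i 1)
    simpa [EuclideanSpace.inner_single_left] using this
  have e2 : ∀ i j : Fin N, i ≠ j →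
      ∫ x : Sph N, (x : Euc N) i ^ 2 * (x : Euc N) j ^ 2 ∂(sphereMeasure N) = m / 3 := by
    intro i j hij
    have hn1 : ‖(EuclideanSpace.single i 1 + EuclideanSpace.single j 1 : Euc N)‖ ^ 2 = 2 := by
      rw [norm_add_sq_real]; simp [EuclideanSpace.inner_single_left, hij]; norm_num
    have hn2 : ‖(EuclideanSpace.single i 1 - EuclideanSpace.single j 1 : Euc N)‖ ^ 2 = 2 := by
      rw [norm_sub_sq_real]; simp [EuclideanSpace.inner_single_left, hij]; norm_num
    have a1 := g (EuclideanSpace.single i 1 + EuclideanSpace.single j 1)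
    have a2 := g (EuclideanSpace.single i 1 - EuclideanSpace.single j 1)
    rw [show ∀ t : ℝ, t ^ 4 = (t ^ 2) ^ 2 from fun t => by ring, hn1] at a1
    rw [show ∀ t : ℝ, t ^ 4 = (t ^ 2) ^ 2 from fun t => by ring, hn2] at a2
    simp only [inner_add_left, inner_sub_left, EuclideanSpace.inner_single_left, map_one, one_mul] at a1 a2
    have hs := integral_add (μ := sphereMeasure N)
      (sph_integrable hN (f := fun x : Sph N => ((x : Euc N) i + (x : Euc N) j) ^ 4) (by fun_prop))
      (sph_integrable hN (f := fun x : Sph N => ((x : Euc N) i - (x : Euc N) j) ^ 4) (by fun_prop))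
    have hs2 : ∫ x : Sph N, (((x : Euc N) i + (x : Euc N) j) ^ 4 + ((x : Euc N) i - (x : Euc N) j) ^ 4) ∂(sphereMeasure N)
        = 2 * m + 2 * m + 12 * ∫ x : Sph N, (x : Euc N) i ^ 2 * (x : Euc N) j ^ 2 ∂(sphereMeasure N) := by
      rw [← e1 i]
      nth_rw 2 [e1 i]
      rw [← e1 j]
      rw [← integral_const_mul, ← integral_const_mul, ← integral_const_mul, ← integral_add, ← integral_add]
      · congr 1; ext x; ring
      all_goals exact sph_integrable hN (by fun_prop)
    linarith
  have tot : ∑ i : Fin N, ∑ j : Fin N,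
      ∫ x : Sph N, (x : Euc N) i ^ 2 * (x : Euc N) j ^ 2 ∂(sphereMeasure N) = 1 := by
    have hin : ∀ i : Fin N, ∑ j : Fin N,
        ∫ x : Sph N, (x : Euc N) i ^ 2 * (x : Euc N) j ^ 2 ∂(sphereMeasure N)
        = ∫ x : Sph N, ∑ j : Fin N, (x : Euc N) i ^ 2 * (x : Euc N) j ^ 2 ∂(sphereMeasure N) :=
      fun i => (integral_finsetSum _ (fun j _ => sph_integrable hN (by fun_prop))).symm
    simp_rw [hin]
    rw [← integral_finsetSum _ (fun i _ => sph_integrable hN (by fun_prop))]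
    have : ∀ x : Sph N, ∑ i : Fin N, ∑ j : Fin N, (x : Euc N) i ^ 2 * (x : Euc N) j ^ 2 = 1 := by
      intro x
      have hx : ∑ i, (x : Euc N) i ^ 2 = 1 := by
        rw [← EuclideanSpace.real_norm_sq_eq]; simp
      simp_rw [← Finset.mul_sum, hx, mul_one, hx]
    simp [this]
  have val : ∀ i j : Fin N, ∫ x : Sph N, (x : Euc N) i ^ 2 * (x : Euc N) j ^ 2 ∂(sphereMeasure N)
      = m / 3 + if i = j then 2 * m / 3 else 0 := by
    intro i j
    by_cases h : i = j
    · subst h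
      simp only [if_true, ← pow_add]
      rw [e1 i]; ring
    · rw [e2 i j h, if_neg h]; ring
  simp_rw [val, Finset.sum_add_distrib] at tot
  simp at tot
  linarith

lemma sph_abs {N : ℕ} (hN : 2 ≤ N) (v : Euc N) :
    9 / (16 * Real.sqrt N) * ‖v‖ ≤ ∫ x : Sph N, |⟪v, (x : Euc N)⟫| ∂(sphereMeasure N) := by
  have hN0 : (0:ℝ) < N := by positivity
  have one : ∀ v : Euc N, ‖v‖ = 1 →
      9 / (16 * Real.sqrt N) ≤ ∫ x : Sph N, |⟪v, (x : Euc N)⟫| ∂(sphereMeasure N) := by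
    intro v hv
    set s := Real.sqrt N with hs
    have hs0 : 0 < s := Real.sqrt_pos.mpr hN0
    have hss : s ^ 2 = N := Real.sq_sqrt hN0.le
    have m2 := sph_m2 hN v
    have m4 := sph_m4 hN v hv
    rw [hv] at m2
    have pt : ∀ t : ℝ, (3 / 4 * s) * t ^ 2 - (s ^ 3 / 16) * t ^ 4 ≤ |t| := by
      intro t
      have h0 : 0 ≤ |t| := abs_nonneg t
      rw [← sq_abs t, show t ^ 4 = |t| ^ 4 by rw [← abs_pow, abs_of_nonneg (by positivity)]]
      have : |t| - ((3 / 4 * s) * |t| ^ 2 - (s ^ 3 / 16) * |t| ^ 4)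
        = |t| / 16 * (s * |t| - 2) ^ 2 * (s * |t| + 4) := by ring
      have : 0 ≤ |t| / 16 * (s * |t| - 2) ^ 2 * (s * |t| + 4) := by positivity
      linarith
    have hint := integral_mono (μ := sphereMeasure N)
      (sph_integrable hN (f := fun x : Sph N => (3 / 4 * s) * ⟪v, (x : Euc N)⟫ ^ 2 - (s ^ 3 / 16) * ⟪v, (x : Euc N)⟫ ^ 4) (by fun_prop))
      (sph_integrable hN (f := fun x : Sph N => |⟪v, (x : Euc N)⟫|) (by fun_prop)) (fun x => pt _)
    refine le_trans ?_ hint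
    rw [integral_sub (sph_integrable hN (by fun_prop)) (sph_integrable hN (by fun_prop)),
      integral_const_mul, integral_const_mul]
    set a := ∫ x : Sph N, ⟪v, (x : Euc N)⟫ ^ 2 ∂(sphereMeasure N)
    set b := ∫ x : Sph N, ⟪v, (x : Euc N)⟫ ^ 4 ∂(sphereMeasure N)
    have hb : 0 ≤ b := integral_nonneg (fun x => by positivity)
    rw [← hss] at m2 m4
    have ha : a = 1 / s ^ 2 := by field_simp; linarith
    have hb' : b ≤ 3 / s ^ 4 := by
      rw [le_div_iff₀ (by positivity)]
      nlinarith [mul_nonneg (sq_nonneg s) hb]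
    have : s ^ 3 / 16 * b ≤ s ^ 3 / 16 * (3 / s ^ 4) := by gcongr
    have e : 3 / 4 * s * (1 / s ^ 2) - s ^ 3 / 16 * (3 / s ^ 4) = 9 / (16 * s) := by
      field_simp; norm_num
    rw [ha]; linarith
  obtain ⟨⟨i⟩⟩ : Nonempty (Nonempty (Fin N)) := ⟨⟨⟨0, by omega⟩⟩⟩
  rw [sph_rot (fun t => |t|) (v := v) (v' := ‖v‖ • EuclideanSpace.single i 1) (by simp [norm_smul])]
  simp only [inner_smul_left, abs_mul, integral_const_mul]
  have := one (EuclideanSpace.single i 1) (by simp)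
  simp only [conj_trivial, abs_norm]
  nlinarith [norm_nonneg v]

lemma sph_pos {N : ℕ} (hN : 2 ≤ N) (v : Euc N) :
    9 / (32 * Real.sqrt N) * ‖v‖ ≤ ∫ x : Sph N, max ⟪v, (x : Euc N)⟫ 0 ∂(sphereMeasure N) := by
  have h := sph_abs hN v
  have e : ∫ x : Sph N, max ⟪v, (x : Euc N)⟫ 0 ∂(sphereMeasure N)
     = ∫ x : Sph N, max (-⟪v, (x : Euc N)⟫) 0 ∂(sphereMeasure N) := by
    rw [sph_rot (fun t => max t 0) (v := v) (v' := -v) (by simp)]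
    simp
  have e2 : ∫ x : Sph N, |⟪v, (x : Euc N)⟫| ∂(sphereMeasure N)
     = ∫ x : Sph N, max ⟪v, (x : Euc N)⟫ 0 ∂(sphereMeasure N)
      + ∫ x : Sph N, max (-⟪v, (x : Euc N)⟫) 0 ∂(sphereMeasure N) := by
    rw [← integral_add (sph_integrable hN (by fun_prop)) (sph_integrable hN (by fun_prop))]
    congr 1; ext x
    rcases le_total 0 ⟪v, (x : Euc N)⟫ with h | h
    · rw [abs_of_nonneg h, max_eq_left h, max_eq_right (by linarith)]; ring
    · rw [abs_of_nonpos h, max_eq_right h, max_eq_left (by linarith)]; ring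
  have e3 : 9 / (16 * Real.sqrt N) * ‖v‖ = 2 * (9 / (32 * Real.sqrt N) * ‖v‖) := by ring
  linarith
/-! ### outreach -/

lemma outreach_bdd {N : ℕ} {B : Set (Euc N)} (hB : IsCompact B) (u : Euc N) :
    BddAbove ((fun b => ⟪b, u⟫) '' B) :=
  (hB.image (by fun_prop)).bddAbove

lemma le_outreach {N : ℕ} {B : Set (Euc N)} (hB : IsCompact B) {u b : Euc N} (hb : b ∈ B) :
    ⟪b, u⟫ ≤ outreach B u :=
  le_csSup (outreach_bdd hB u) ⟨b, hb, rfl⟩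

lemma outreach_le {N : ℕ} {B : Set (Euc N)} (hne : B.Nonempty) {u : Euc N} {t : ℝ}
    (h : ∀ b ∈ B, ⟪b, u⟫ ≤ t) : outreach B u ≤ t := by
  refine csSup_le (hne.image _) ?_
  rintro _ ⟨b, hb, rfl⟩
  exact h b hb

lemma outreach_sub_le {N : ℕ} {B : Set (Euc N)} (hne : B.Nonempty) (hB : IsCompact B) {R : ℝ}
    (hR : ∀ b ∈ B, ‖b‖ ≤ R) (u v : Euc N) : outreach B u ≤ outreach B v + R * ‖u - v‖ := by
  refine outreach_le hne fun b hb => ?_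
  have h1 := le_outreach hB (u := v) hb
  have h2 : ⟪b, u - v⟫ ≤ R * ‖u - v‖ :=
    (real_inner_le_norm _ _).trans (by gcongr; exact hR b hb)
  rw [inner_sub_right] at h2
  linarith

lemma exists_bound {N : ℕ} {B : Set (Euc N)} (hB : IsCompact B) :
    ∃ R : ℝ, 0 ≤ R ∧ ∀ b ∈ B, ‖b‖ ≤ R := by
  obtain ⟨R, hR⟩ := hB.isBounded.exists_norm_le
  exact ⟨max R 0, le_max_right _ _, fun b hb => (hR b hb).trans (le_max_left _ _)⟩

lemma outreach_lip {N : ℕ} {B : Set (Euc N)} (hne : B.Nonempty) (hB : IsCompact B) {R : ℝ}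
    (hR0 : 0 ≤ R) (hR : ∀ b ∈ B, ‖b‖ ≤ R) :
    LipschitzWith ⟨R, hR0⟩ (outreach B) := by
  refine LipschitzWith.of_le_add_mul _ fun u v => ?_
  rw [dist_eq_norm]
  exact outreach_sub_le hne hB hR u v

lemma outreach_cont {N : ℕ} {B : Set (Euc N)} (hne : B.Nonempty) (hB : IsCompact B) :
    Continuous (outreach B) := by
  obtain ⟨R, hR0, hR⟩ := exists_bound hB
  exact (outreach_lip hne hB hR0 hR).continuous

lemma outreach_integrable {N : ℕ} (hN : 2 ≤ N) {B : Set (Euc N)} (hne : B.Nonempty)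
    (hB : IsCompact B) :
    Integrable (fun x : Sph N => outreach B (x : Euc N)) (sphereMeasure N) :=
  sph_integrable hN ((outreach_cont hne hB).comp continuous_subtype_val)

lemma outreach_abs_le {N : ℕ} {B : Set (Euc N)} (hne : B.Nonempty) (hB : IsCompact B) {R : ℝ}
    (hR : ∀ b ∈ B, ‖b‖ ≤ R) {u : Euc N} (hu : ‖u‖ = 1) : |outreach B u| ≤ R := by
  rw [abs_le]
  obtain ⟨b, hb⟩ := hne
  constructor
  · have h1 := le_outreach hB (u := u) hb
    have h2 := abs_real_inner_le_norm b u
    rw [hu, mul_one] at h2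
    have := (abs_le.mp h2).1
    linarith [hR b hb]
  · refine outreach_le ⟨b, hb⟩ fun c hc => ?_
    have := real_inner_le_norm c u
    rw [hu, mul_one] at this
    exact this.trans (hR c hc)

lemma supNorm_le {N : ℕ} {f : Euc N → ℝ} {M : ℝ} (hM : 0 ≤ M)
    (h : ∀ u : Euc N, ‖u‖ = 1 → |f u| ≤ M) : supNormSphere f ≤ M :=
  Real.iSup_le (fun x => h x (by simp)) hM

lemma supNorm_nonneg {N : ℕ} (f : Euc N → ℝ) : 0 ≤ supNormSphere f :=
  Real.iSup_nonneg fun _ => abs_nonneg _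

lemma le_supNorm {N : ℕ} {f : Euc N → ℝ} {L : ℝ≥0}
    (hf : LipschitzOnWith L f (Metric.sphere (0 : Euc N) 1)) {u : Euc N} (hu : ‖u‖ = 1) :
    |f u| ≤ supNormSphere f := by
  have : BddAbove (range fun x : Sph N => |f x|) := by
    have h := ((isCompact_sphere (0 : Euc N) 1).image_of_continuousOn
      hf.continuousOn.abs).bddAbove
    rwa [image_eq_range] at h
  exact le_ciSup this (⟨u, by simp [hu]⟩ : Sph N)

/-- Outreach vs. the Hausdorff distance. -/
lemma outreach_le_dist {N : ℕ} (K K' : NonemptyCompacts (Euc N)) {u : Euc N} (hu : ‖u‖ = 1) :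
    outreach (K : Set (Euc N)) u ≤ outreach (K' : Set (Euc N)) u + dist K K' := by
  refine outreach_le K.nonempty fun b hb => ?_
  obtain ⟨c, hc, hbc⟩ := K'.isCompact.exists_infDist_eq_dist K'.nonempty b
  have h1 : dist b c ≤ dist K K' := by
    rw [← hbc, NonemptyCompacts.dist_eq]
    exact infDist_le_hausdorffDist_of_mem hb
      (hausdorffEDist_ne_top_of_nonempty_of_bounded K.nonempty K'.nonempty
        K.isCompact.isBounded K'.isCompact.isBounded)
  have h2 := real_inner_le_norm (b - c) u
  rw [hu, mul_one, inner_sub_left, ← dist_eq_norm] at h2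
  have := le_outreach K'.isCompact (u := u) hc
  linarith

lemma outreach_cont_K {N : ℕ} {u : Euc N} (hu : ‖u‖ = 1) :
    Continuous fun K : NonemptyCompacts (Euc N) => outreach (K : Set (Euc N)) u := by
  have : LipschitzWith 1 fun K : NonemptyCompacts (Euc N) => outreach (K : Set (Euc N)) u :=
    LipschitzWith.of_le_add fun K K' => outreach_le_dist K K' hu
  exact this.continuous

lemma mhw_cont {N : ℕ} (hN : 2 ≤ N) :
    Continuous fun K : NonemptyCompacts (Euc N) => meanHalfWidth (K : Set (Euc N)) := by
  have : LipschitzWith 1 fun K : NonemptyCompacts (Euc N) => meanHalfWidth (K : Set (Euc N)) := by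
    refine LipschitzWith.of_le_add fun K K' => ?_
    have := sphereMeasure_prob hN
    have h := integral_mono (μ := sphereMeasure N)
      (outreach_integrable hN K.nonempty K.isCompact)
      ((outreach_integrable hN K'.nonempty K'.isCompact).add (integrable_const (dist K K')))
      (fun x => outreach_le_dist K K' (by simp))
    simp only [Pi.add_apply] at h
    rw [integral_add (outreach_integrable hN K'.nonempty K'.isCompact) (integrable_const _)] at h
    simpa [meanHalfWidth] using h
  exact this.continuous

lemma convex_closed {N : ℕ} :
    IsClosed {K : NonemptyCompacts (Euc N) | Convex ℝ (K : Set (Euc N))} := by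
  refine isClosed_of_closure_subset fun K hK => ?_
  rw [Metric.mem_closure_iff] at hK
  intro x hx y hy a b ha hb hab
  rw [← K.isCompact.isClosed.closure_eq, Metric.mem_closure_iff]
  intro e he
  obtain ⟨K', hK', hd⟩ := hK (e / 2) (by positivity)
  have fin := hausdorffEDist_ne_top_of_nonempty_of_bounded K.nonempty K'.nonempty
        K.isCompact.isBounded K'.isCompact.isBounded
  rw [NonemptyCompacts.dist_eq] at hd
  obtain ⟨x', hx', hxx⟩ := exists_dist_lt_of_hausdorffDist_lt hx hd fin
  obtain ⟨y', hy', hyy⟩ := exists_dist_lt_of_hausdorffDist_lt hy hd fin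
  obtain ⟨z, hz, hzz⟩ := exists_dist_lt_of_hausdorffDist_lt' (hK' hx' hy' ha hb hab) hd fin
  refine ⟨z, hz, ?_⟩
  have h1 : dist (a • x + b • y) (a • x' + b • y') ≤ e / 2 := by
    rw [dist_eq_norm] at hxx hyy ⊢
    have : a • x + b • y - (a • x' + b • y') = a • (x - x') + b • (y - y') := by module
    rw [this]
    refine (norm_add_le _ _).trans ?_
    rw [norm_smul, norm_smul, Real.norm_of_nonneg ha, Real.norm_of_nonneg hb]
    have : e / 2 = a * (e / 2) + b * (e / 2) := by rw [← add_mul, hab, one_mul]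
    rw [this]
    gcongr
  have := dist_triangle (a • x + b • y) (a • x' + b • y') z
  rw [dist_comm z] at hzz
  linarith

open scoped Pointwise in
/-- Thickening by `r`. -/
def thick {N : ℕ} (K : NonemptyCompacts (Euc N)) (r : ℝ) (hr : 0 ≤ r) :
    NonemptyCompacts (Euc N) :=
  ⟨⟨(K : Set (Euc N)) + closedBall 0 r, K.isCompact.add (isCompact_closedBall _ _)⟩,
    K.nonempty.add ⟨0, by simpa using hr⟩⟩

open scoped Pointwise in
lemma coe_thick {N : ℕ} (K : NonemptyCompacts (Euc N)) (r : ℝ) (hr : 0 ≤ r) :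
    (thick K r hr : Set (Euc N)) = (K : Set (Euc N)) + closedBall 0 r := rfl

lemma thick_convex {N : ℕ} {K : NonemptyCompacts (Euc N)} (h : Convex ℝ (K : Set (Euc N)))
    (r : ℝ) (hr : 0 ≤ r) : Convex ℝ (thick K r hr : Set (Euc N)) := by
  rw [coe_thick]
  exact h.add (convex_closedBall _ _)

lemma thick_dist {N : ℕ} (K : NonemptyCompacts (Euc N)) (r : ℝ) (hr : 0 ≤ r) :
    dist K (thick K r hr) ≤ r := by
  rw [NonemptyCompacts.dist_eq, coe_thick]
  refine hausdorffDist_le_of_mem_dist hr (fun x hx => ⟨x, ?_, by simpa using hr⟩) ?_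
  · exact ⟨x, hx, 0, by simpa using hr, by simp⟩
  · rintro _ ⟨x, hx, y, hy, rfl⟩
    exact ⟨x, hx, by simpa using hy⟩

lemma thick_outreach {N : ℕ} (K : NonemptyCompacts (Euc N)) (r : ℝ) (hr : 0 ≤ r) {u : Euc N}
    (hu : ‖u‖ = 1) :
    outreach (thick K r hr : Set (Euc N)) u = outreach (K : Set (Euc N)) u + r := by
  apply le_antisymm
  · have := outreach_le_dist (thick K r hr) K hu
    rw [dist_comm] at this
    linarith [thick_dist K r hr]
  · have : outreach (K : Set (Euc N)) u ≤ outreach (thick K r hr : Set (Euc N)) u - r := by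
      refine outreach_le K.nonempty fun b hb => ?_
      have hm : b + r • u ∈ (thick K r hr : Set (Euc N)) :=
        ⟨b, hb, r • u, by simp [norm_smul, hu, abs_of_nonneg hr], rfl⟩
      have := le_outreach (thick K r hr).isCompact (u := u) hm
      rw [inner_add_left, inner_smul_left, real_inner_self_eq_norm_sq, hu] at this
      simp at this
      linarith
    linarith

lemma thick_mhw {N : ℕ} (hN : 2 ≤ N) (K : NonemptyCompacts (Euc N)) (r : ℝ) (hr : 0 ≤ r) :
    meanHalfWidth (thick K r hr : Set (Euc N)) = meanHalfWidth (K : Set (Euc N)) + r := by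
  have := sphereMeasure_prob hN
  unfold meanHalfWidth
  have h : ∀ x : Sph N, outreach (thick K r hr : Set (Euc N)) (x : Euc N)
      = outreach (K : Set (Euc N)) (x : Euc N) + r := fun x => thick_outreach K r hr (by simp)
  simp_rw [h]
  rw [integral_add (outreach_integrable hN K.nonempty K.isCompact) (integrable_const _)]
  simp
/-! ### the continuous problem -/

lemma cont_bound {N : ℕ} (hN : 2 ≤ N) {C : Euc N → ℝ} {LC : ℝ≥0}
    (hC : LipschitzOnWith LC C (Metric.sphere (0 : Euc N) 1)) {B : Set (Euc N)}
    (hB : B ∈ CInf C) {b : Euc N} (hb : b ∈ B) :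
    9 / (32 * Real.sqrt N) * ‖b‖ ≤ meanHalfWidth B + supNormSphere C := by
  have := sphereMeasure_prob hN
  obtain ⟨hne, hcv, hcp, hf⟩ := hB
  refine (sph_pos hN b).trans ?_
  have h := integral_mono (μ := sphereMeasure N)
    (sph_integrable hN (f := fun x : Sph N => max ⟪b, (x : Euc N)⟫ 0) (by fun_prop))
    ((outreach_integrable hN hne hcp).add (integrable_const (supNormSphere C)))
    (fun x => ?_)
  · simp only [Pi.add_apply] at h
    rw [integral_add (outreach_integrable hN hne hcp) (integrable_const _)] at h
    simpa [meanHalfWidth] using h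
  · have h1 := hf x x.2
    have h2 := (abs_le.mp (le_supNorm hC (u := x) (by simp))).1
    have h3 := le_outreach hcp (u := x) hb
    have h4 := supNorm_nonneg C
    simp only [Pi.add_apply]
    refine max_le ?_ ?_ <;> linarith

lemma VCP_bdd {N : ℕ} (hN : 2 ≤ N) {C : Euc N → ℝ} {LC : ℝ≥0}
    (hC : LipschitzOnWith LC C (Metric.sphere (0 : Euc N) 1)) :
    BddBelow (meanHalfWidth '' CInf C) := by
  refine ⟨-supNormSphere C, ?_⟩
  rintro _ ⟨B, hB, rfl⟩
  obtain ⟨b, hb⟩ := hB.1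
  have := cont_bound hN hC hB hb
  have : 0 ≤ 9 / (32 * Real.sqrt N) * ‖b‖ := by positivity
  linarith

lemma VCP_le {N : ℕ} (hN : 2 ≤ N) {C : Euc N → ℝ} {LC : ℝ≥0}
    (hC : LipschitzOnWith LC C (Metric.sphere (0 : Euc N) 1)) {B : Set (Euc N)}
    (hB : B ∈ CInf C) : VCP C ≤ meanHalfWidth B :=
  csInf_le (VCP_bdd hN hC) ⟨B, hB, rfl⟩

/-- The ball of radius `‖C‖`. -/
def bigBall {N : ℕ} (C : Euc N → ℝ) : NonemptyCompacts (Euc N) :=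
  thick {0} (supNormSphere C) (supNorm_nonneg C)

lemma bigBall_outreach {N : ℕ} (C : Euc N → ℝ) {u : Euc N} (hu : ‖u‖ = 1) :
    outreach (bigBall C : Set (Euc N)) u = supNormSphere C := by
  rw [bigBall, thick_outreach _ _ _ hu]
  simp [outreach]

lemma bigBall_convex {N : ℕ} (C : Euc N → ℝ) : Convex ℝ (bigBall C : Set (Euc N)) :=
  thick_convex (by simp) _ _

lemma bigBall_mem {N : ℕ} {C : Euc N → ℝ} {LC : ℝ≥0}
    (hC : LipschitzOnWith LC C (Metric.sphere (0 : Euc N) 1)) :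
    (bigBall C : Set (Euc N)) ∈ CInf C := by
  refine ⟨(bigBall C).nonempty, bigBall_convex C, (bigBall C).isCompact, fun u hu => ?_⟩
  have hu' : ‖u‖ = 1 := by simpa using hu
  rw [bigBall_outreach C hu']
  exact (le_abs_self _).trans (le_supNorm hC hu')

lemma VCP_le_sup {N : ℕ} (hN : 2 ≤ N) {C : Euc N → ℝ} {LC : ℝ≥0}
    (hC : LipschitzOnWith LC C (Metric.sphere (0 : Euc N) 1)) : VCP C ≤ supNormSphere C := by
  have := sphereMeasure_prob hN
  refine (VCP_le hN hC (bigBall_mem hC)).trans ?_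
  have h : ∀ x : Sph N, outreach (bigBall C : Set (Euc N)) (x : Euc N) = supNormSphere C :=
    fun x => bigBall_outreach C (by simp)
  simp [meanHalfWidth, h]

/-- near optimal sets as nonempty compacts -/
def CG {N : ℕ} (C : Euc N → ℝ) (Γ : ℝ) : Set (NonemptyCompacts (Euc N)) :=
  {K | (K : Set (Euc N)) ∈ CGamma C Γ}

lemma CG_compact {N : ℕ} (hN : 2 ≤ N) {C : Euc N → ℝ} {LC : ℝ≥0}
    (hC : LipschitzOnWith LC C (Metric.sphere (0 : Euc N) 1)) (Γ : ℝ) :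
    IsCompact (CG C Γ) := by
  have hs : 0 < Real.sqrt N := Real.sqrt_pos.mpr (by positivity)
  set R := (VCP C + Γ + supNormSphere C) / (9 / (32 * Real.sqrt N)) with hR
  have h1 := NonemptyCompacts.isCompact_subsets_of_isCompact
    (isCompact_closedBall (0 : Euc N) R)
  refine h1.of_isClosed_subset ?_ ?_
  · have e : CG C Γ = {K : NonemptyCompacts (Euc N) | Convex ℝ (K : Set (Euc N))} ∩
        ((⋂ x : Sph N, {K : NonemptyCompacts (Euc N) | C x ≤ outreach (K : Set (Euc N)) x}) ∩
        {K : NonemptyCompacts (Euc N) | meanHalfWidth (K : Set (Euc N)) - VCP C ≤ Γ}) := by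
      ext K
      constructor
      · rintro ⟨⟨-, h2, -, h4⟩, h5⟩
        exact ⟨h2, mem_iInter.mpr fun x => h4 x x.2, h5⟩
      · rintro ⟨h2, h4, h5⟩
        exact ⟨⟨K.nonempty, h2, K.isCompact, fun u hu => mem_iInter.mp h4 ⟨u, hu⟩⟩, h5⟩
    rw [e]
    refine convex_closed.inter (IsClosed.inter (isClosed_iInter fun x => ?_) ?_)
    · exact isClosed_le continuous_const (outreach_cont_K (by simp))
    · exact isClosed_le ((mhw_cont hN).sub continuous_const) continuous_const
  · intro K hK b hb
    have := cont_bound hN hC hK.1 hb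
    rw [mem_closedBall_zero_iff, hR, le_div_iff₀ (by positivity), mul_comm]
    have := hK.2
    linarith

lemma C0_nonempty {N : ℕ} (hN : 2 ≤ N) {C : Euc N → ℝ} {LC : ℝ≥0}
    (hC : LipschitzOnWith LC C (Metric.sphere (0 : Euc N) 1)) : (CG C 0).Nonempty := by
  have hne : (CG C 1).Nonempty := by
    obtain ⟨_, ⟨B, hB, rfl⟩, h⟩ := exists_lt_of_csInf_lt
      (s := meanHalfWidth '' CInf C) ⟨_, _, bigBall_mem hC, rfl⟩
      (show sInf (meanHalfWidth '' CInf C) < VCP C + 1 by rw [← VCP]; linarith)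
    refine ⟨⟨⟨B, hB.2.2.1⟩, hB.1⟩, hB, ?_⟩
    change meanHalfWidth B - VCP C ≤ 1
    linarith
  obtain ⟨K, hK, hmin⟩ := (CG_compact hN hC 1).exists_isMinOn hne (mhw_cont hN).continuousOn
  refine ⟨K, hK.1, ?_⟩
  have : meanHalfWidth (K : Set (Euc N)) ≤ VCP C := by
    refine le_csInf ⟨_, _, bigBall_mem hC, rfl⟩ ?_
    rintro _ ⟨B, hB, rfl⟩
    by_cases h : meanHalfWidth B - VCP C ≤ 1
    · exact hmin (a := (⟨⟨B, hB.2.2.1⟩, hB.1⟩ : NonemptyCompacts (Euc N))) ⟨hB, h⟩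
    · have := hK.2
      linarith
  linarith

lemma C_stable {N : ℕ} (hN : 2 ≤ N) {C : Euc N → ℝ} {LC : ℝ≥0}
    (hC : LipschitzOnWith LC C (Metric.sphere (0 : Euc N) 1)) {ρ : ℝ} (hρ : 0 < ρ) :
    ∃ Γ > 0, ∀ K ∈ CG C Γ, infDist K (CG C 0) ≤ ρ := by
  set A := CG C 1 ∩ {K | ρ ≤ infDist K (CG C 0)} with hA
  have hAc : IsCompact A := (CG_compact hN hC 1).inter_right
    (isClosed_le continuous_const (continuous_infDist_pt _))
  rcases A.eq_empty_or_nonempty with h | h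
  · refine ⟨1, one_pos, fun K hK => ?_⟩
    by_contra hcon
    have : K ∈ A := ⟨hK, (not_le.mp hcon).le⟩
    rw [h] at this
    exact this
  · obtain ⟨K0, hK0, hmin⟩ := hAc.exists_isMinOn h (mhw_cont hN).continuousOn
    have hpos : 0 < meanHalfWidth (K0 : Set (Euc N)) - VCP C := by
      by_contra hcon
      have : K0 ∈ CG C 0 := ⟨hK0.1.1, not_lt.mp hcon⟩
      have h2 := hK0.2
      rw [mem_ofPred_eq, infDist_zero_of_mem this] at h2
      linarith
    refine ⟨min 1 ((meanHalfWidth (K0 : Set (Euc N)) - VCP C) / 2), by positivity, fun K hK => ?_⟩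
    by_contra hcon
    have h2 := le_min_iff.mp hK.2
    have : K ∈ A := ⟨⟨hK.1, h2.1⟩, (not_le.mp hcon).le⟩
    have h3 : meanHalfWidth (K0 : Set (Euc N)) ≤ meanHalfWidth (K : Set (Euc N)) := hmin this
    linarith [h2.2]

/-! ### the discrete problem -/

lemma quad_eps {N : ℕ} (hN : 2 ≤ N) {m : ℕ} {u : Fin m → Euc N} {w : Fin m → ℝ} {ε : ℝ}
    (hq : IsAccurateQuadrature u w ε) : 0 ≤ ε ∧ |1 - ∑ i, w i| ≤ ε := by
  have := sphereMeasure_prob hN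
  have : Nonempty (Fin N) := ⟨⟨0, by omega⟩⟩
  have : Nonempty (Sph N) := ⟨⟨EuclideanSpace.single ⟨0, by omega⟩ 1, by simp⟩⟩
  have h := hq.2.2 0 (fun _ => 1) (LipschitzWith.const (1:ℝ)).lipschitzOnWith
  simp [supNormSphere] at h
  exact ⟨(abs_nonneg _).trans h, h⟩

lemma quad_err {N : ℕ} (hN : 2 ≤ N) {m : ℕ} {u : Fin m → Euc N} {w : Fin m → ℝ} {ε : ℝ}
    (hq : IsAccurateQuadrature u w ε) {B : Set (Euc N)} (hne : B.Nonempty) (hB : IsCompact B)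
    {R : ℝ} (hR0 : 0 ≤ R) (hR : ∀ b ∈ B, ‖b‖ ≤ R) :
    |meanHalfWidth B - quadSum u w B| ≤ 2 * ε * R := by
  have h := hq.2.2 ⟨R, hR0⟩ (outreach B) (outreach_lip hne hB hR0 hR).lipschitzOnWith
  have h2 := supNorm_le hR0 (fun v hv => outreach_abs_le hne hB hR hv)
  refine h.trans ?_
  change ε * (R + supNormSphere (outreach B)) ≤ 2 * ε * R
  change supNormSphere (outreach B) ≤ R at h2
  have := (quad_eps hN hq).1
  nlinarith

lemma disc_bound {N : ℕ} (hN : 2 ≤ N) {m : ℕ} {u : Fin m → Euc N} {w : Fin m → ℝ} {ε : ℝ}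
    (hq : IsAccurateQuadrature u w ε) {C : Euc N → ℝ} {LC : ℝ≥0}
    (hC : LipschitzOnWith LC C (Metric.sphere (0 : Euc N) 1)) {B : Set (Euc N)}
    (hB : B ∈ DInf C (range u)) {b : Euc N} (hb : b ∈ B) :
    (9 / (32 * Real.sqrt N) - 2 * ε) * ‖b‖ ≤ quadSum u w B + supNormSphere C * ∑ i, w i := by
  obtain ⟨hne, hcv, hcp, hf⟩ := hB
  have h0 := sph_pos hN b
  have hlip : LipschitzWith ‖b‖₊ fun x : Euc N => max ⟪b, x⟫ 0 := by
    refine LipschitzWith.of_le_add_mul _ fun x y => ?_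
    have h1 : ⟪b, x - y⟫ ≤ ‖b‖ * ‖x - y‖ := real_inner_le_norm _ _
    rw [inner_sub_right] at h1
    have h2 : 0 ≤ ‖b‖ * ‖x - y‖ := by positivity
    rw [dist_eq_norm, coe_nnnorm]
    refine max_le ?_ ?_
    · linarith [le_max_left ⟪b, y⟫ 0]
    · linarith [le_max_right ⟪b, y⟫ 0]
  have hsup : supNormSphere (fun x : Euc N => max ⟪b, x⟫ 0) ≤ ‖b‖ := by
    refine supNorm_le (norm_nonneg b) fun x hx => ?_
    rw [abs_of_nonneg (le_max_right _ _)]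
    refine max_le ?_ (norm_nonneg b)
    have := real_inner_le_norm b x
    rwa [hx, mul_one] at this
  have h := hq.2.2 ‖b‖₊ _ hlip.lipschitzOnWith
  rw [coe_nnnorm] at h
  have hs : ∑ i, w i * max ⟪b, u i⟫ 0 ≤ quadSum u w B + supNormSphere C * ∑ i, w i := by
    rw [quadSum, Finset.mul_sum, ← Finset.sum_add_distrib]
    refine Finset.sum_le_sum fun i _ => ?_
    rw [mul_comm (supNormSphere C), ← mul_add]
    refine mul_le_mul_of_nonneg_left ?_ (hq.2.1 i)
    have hu : ‖u i‖ = 1 := by simpa using hq.1 i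
    have h1 := hf (u i) ⟨i, rfl⟩
    have h2 := (abs_le.mp (le_supNorm hC hu)).1
    have h3 := le_outreach hcp (u := u i) hb
    have h4 := supNorm_nonneg C
    refine max_le ?_ ?_ <;> linarith
  have h5 := (abs_le.mp h).2
  have he := (quad_eps hN hq).1
  have : ε * (‖b‖ + supNormSphere fun x : Euc N => max ⟪b, x⟫ 0) ≤ ε * (‖b‖ + ‖b‖) := by gcongr
  linarith

lemma disp_le {N : ℕ} {m : ℕ} {u : Fin m → Euc N} (hu : ∀ i, ‖u i‖ = 1) (hm : 0 < m)
    {v : Euc N} (hv : ‖v‖ = 1) : ∃ i, ‖v - u i‖ ≤ dispersion (range u) := by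
  have : Nonempty (range u) := ⟨⟨_, ⟨0, hm⟩, rfl⟩⟩
  have hb : ∀ x : Sph N, BddBelow (range fun y : range u => ‖(x : Euc N) - (y : Euc N)‖) :=
    fun x => ⟨0, by rintro _ ⟨y, rfl⟩; positivity⟩
  have hbdd : BddAbove (range fun x : Sph N => ⨅ y : range u, ‖(x : Euc N) - (y : Euc N)‖) := by
    refine ⟨2, ?_⟩
    rintro _ ⟨x, rfl⟩
    refine (ciInf_le (hb x) ⟨_, ⟨0, hm⟩, rfl⟩).trans ?_
    refine (norm_sub_le _ _).trans ?_
    rw [hu]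
    have : ‖(x : Euc N)‖ = 1 := by simp
    rw [this]; norm_num
  have h1 := le_ciSup hbdd (⟨v, by simp [hv]⟩ : Sph N)
  obtain ⟨⟨_, i, rfl⟩, hi⟩ := exists_eq_ciInf_of_finite
    (f := fun y : range u => ‖v - (y : Euc N)‖)
  exact ⟨i, by rw [← hi] at h1; exact h1⟩

lemma VDP_bdd {N : ℕ} (hN : 2 ≤ N) {m : ℕ} {u : Fin m → Euc N} {w : Fin m → ℝ} {ε : ℝ}
    (hq : IsAccurateQuadrature u w ε) {C : Euc N → ℝ} {LC : ℝ≥0}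
    (hC : LipschitzOnWith LC C (Metric.sphere (0 : Euc N) 1))
    (hsm : 2 * ε ≤ 9 / (32 * Real.sqrt N)) :
    BddBelow (quadSum u w '' DInf C (range u)) := by
  refine ⟨-(supNormSphere C * ∑ i, w i), ?_⟩
  rintro _ ⟨B, hB, rfl⟩
  obtain ⟨b, hb⟩ := hB.1
  have := disc_bound hN hq hC hB hb
  have : 0 ≤ (9 / (32 * Real.sqrt N) - 2 * ε) * ‖b‖ :=
    mul_nonneg (by linarith) (norm_nonneg b)
  linarith

lemma CInf_sub {N : ℕ} {m : ℕ} {u : Fin m → Euc N} {w : Fin m → ℝ} {ε : ℝ}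
    (hq : IsAccurateQuadrature u w ε) {C : Euc N → ℝ} {B : Set (Euc N)} (hB : B ∈ CInf C) :
    B ∈ DInf C (range u) := by
  obtain ⟨h1, h2, h3, h4⟩ := hB
  refine ⟨h1, h2, h3, ?_⟩
  rintro _ ⟨i, rfl⟩
  exact h4 _ (hq.1 i)

lemma small_aux {s ε : ℝ} (hs : 0 < s) (h : ε * (1 + 8 * s) ≤ 1 / 8) :
    (1 + ε) / (4 * s) ≤ 9 / (32 * s) - 2 * ε := by
  have e : 9 / (32 * s) - 2 * ε = (9 / 8 - 8 * s * ε) / (4 * s) := by field_simp; ring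
  rw [e]
  gcongr
  linarith

lemma disc_norm {N : ℕ} (hN : 2 ≤ N) {m : ℕ} {u : Fin m → Euc N} {w : Fin m → ℝ} {ε : ℝ}
    (hq : IsAccurateQuadrature u w ε) {C : Euc N → ℝ} {LC : ℝ≥0}
    (hC : LipschitzOnWith LC C (Metric.sphere (0 : Euc N) 1))
    (hsm : ε * (1 + 8 * Real.sqrt N) ≤ 1 / 8) {η : ℝ} (hη : 0 ≤ η) {B : Set (Euc N)}
    (hB : B ∈ DInf C (range u)) (hBη : quadSum u w B ≤ VDP u w C + η) {b : Euc N} (hb : b ∈ B) :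
    ‖b‖ ≤ 8 * Real.sqrt N * supNormSphere C + 4 * Real.sqrt N * η := by
  have hs : 0 < Real.sqrt N := Real.sqrt_pos.mpr (by positivity)
  obtain ⟨he, hw⟩ := quad_eps hN hq
  have hw' : ∑ i, w i ≤ 1 + ε := by linarith [(abs_le.mp hw).1]
  have h4 := small_aux hs hsm
  set s := Real.sqrt N
  set M := supNormSphere C with hM
  have hM0 : 0 ≤ M := supNorm_nonneg C
  have h1 := disc_bound hN hq hC hB hb
  have hpos : 0 ≤ (1 + ε) / (4 * s) := by positivity
  have h2 : VDP u w C ≤ M * ∑ i, w i := by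
    refine (csInf_le (VDP_bdd hN hq hC (by linarith))
      ⟨_, CInf_sub hq (bigBall_mem hC), rfl⟩).trans ?_
    rw [quadSum, Finset.mul_sum]
    refine Finset.sum_le_sum fun i _ => ?_
    rw [bigBall_outreach C (by simpa using hq.1 i), mul_comm]
  have h3 : M * ∑ i, w i ≤ M * (1 + ε) := by gcongr
  have h5 : (1 + ε) / (4 * s) * ‖b‖ ≤ 2 * M * (1 + ε) + η * (1 + ε) := by
    have : (1 + ε) / (4 * s) * ‖b‖ ≤ (9 / (32 * s) - 2 * ε) * ‖b‖ := by gcongr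
    nlinarith
  have h6 : (1 + ε) / (4 * s) * ‖b‖ ≤ (1 + ε) / (4 * s) * (8 * s * M + 4 * s * η) := by
    refine h5.trans (le_of_eq ?_)
    field_simp
    ring
  exact le_of_mul_le_mul_left h6 (by positivity)

/-- Thickened discrete-feasible sets are feasible. -/
lemma disc_thick {N : ℕ} {m : ℕ} {u : Fin m → Euc N} (hu : ∀ i, ‖u i‖ = 1) (hm : 0 < m)
    {C : Euc N → ℝ} {LC : ℝ≥0}
    (hC : LipschitzOnWith LC C (Metric.sphere (0 : Euc N) 1)) {K : NonemptyCompacts (Euc N)}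
    (hK : (K : Set (Euc N)) ∈ DInf C (range u)) {R : ℝ} (hR0 : 0 ≤ R)
    (hR : ∀ b ∈ (K : Set (Euc N)), ‖b‖ ≤ R) (r : ℝ) (hr : 0 ≤ r)
    (hr' : r = dispersion (range u) * (R + LC)) :
    (thick K r hr : Set (Euc N)) ∈ CInf C := by
  refine ⟨(thick K r hr).nonempty, thick_convex hK.2.1 _ _, (thick K r hr).isCompact,
    fun v hv => ?_⟩
  have hv' : ‖v‖ = 1 := by simpa using hv
  rw [thick_outreach _ _ _ hv']
  obtain ⟨i, hi⟩ := disp_le hu hm hv'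
  have h1 := outreach_sub_le K.nonempty K.isCompact hR (u i) v
  have h2 := hK.2.2.2 (u i) ⟨i, rfl⟩
  have h3 := hC.dist_le_mul v hv (u i) (by simpa using hu i)
  rw [Real.dist_eq, dist_eq_norm] at h3
  have h4 := (abs_le.mp h3).2
  rw [norm_sub_rev] at h1
  have h5 : (R + LC) * ‖v - u i‖ ≤ (R + LC) * dispersion (range u) := by gcongr
  rw [hr']
  linarith

lemma disp_nonneg {N : ℕ} (S : Set (Euc N)) : 0 ≤ dispersion S :=
  Real.iSup_nonneg fun _ => Real.iInf_nonneg fun _ => norm_nonneg _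

/-- Transfer from discrete near optimality to continuous near optimality. -/
lemma disc_transfer {N : ℕ} (hN : 2 ≤ N) {m : ℕ} {u : Fin m → Euc N} {w : Fin m → ℝ} {ε δ : ℝ}
    (hq : IsAccurateQuadrature u w ε) (hδ : δ = dispersion (range u))
    {C : Euc N → ℝ} {LC : ℝ≥0}
    (hC : LipschitzOnWith LC C (Metric.sphere (0 : Euc N) 1))
    (hsm : ε * (1 + 8 * Real.sqrt N) ≤ 1 / 8) {η : ℝ} (hη : 0 ≤ η)
    {K : NonemptyCompacts (Euc N)}
    (hK : (K : Set (Euc N)) ∈ DInf C (range u))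
    (hKη : quadSum u w (K : Set (Euc N)) ≤ VDP u w C + η) {R : ℝ}
    (hR : R = 8 * Real.sqrt N * supNormSphere C + 4 * Real.sqrt N * η) :
    ∃ K' : NonemptyCompacts (Euc N), (K' : Set (Euc N)) ∈ CInf C ∧ dist K K' ≤ δ * (R + LC) ∧
      meanHalfWidth (K' : Set (Euc N)) ≤ VDP u w C + η + 2 * ε * R + δ * (R + LC) := by
  have hu : ∀ i, ‖u i‖ = 1 := fun i => by simpa using hq.1 i
  obtain ⟨he, hw⟩ := quad_eps hN hq
  have hs : 0 < Real.sqrt N := Real.sqrt_pos.mpr (by positivity)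
  have hm : 0 < m := by
    rcases Nat.eq_zero_or_pos m with rfl | h
    · simp at hw
      nlinarith
    · exact h
  have hM0 : 0 ≤ supNormSphere C := supNorm_nonneg C
  have hR0 : 0 ≤ R := by rw [hR]; positivity
  have hb : ∀ b ∈ (K : Set (Euc N)), ‖b‖ ≤ R := fun b hb => by
    rw [hR]; exact disc_norm hN hq hC hsm hη hK hKη hb
  have hδ0 : 0 ≤ δ := hδ ▸ disp_nonneg _
  have hr : 0 ≤ δ * (R + LC) := by positivity
  refine ⟨thick K _ hr, disc_thick hu hm hC hK hR0 hb _ hr (by rw [hδ]), thick_dist K _ hr, ?_⟩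
  rw [thick_mhw hN]
  have := (abs_le.mp (quad_err hN hq K.nonempty K.isCompact hR0 hb)).2
  linarith

lemma VCP_le_VDP {N : ℕ} (hN : 2 ≤ N) {m : ℕ} {u : Fin m → Euc N} {w : Fin m → ℝ} {ε δ : ℝ}
    (hq : IsAccurateQuadrature u w ε) (hδ : δ = dispersion (range u))
    {C : Euc N → ℝ} {LC : ℝ≥0}
    (hC : LipschitzOnWith LC C (Metric.sphere (0 : Euc N) 1))
    (hsm : ε * (1 + 8 * Real.sqrt N) ≤ 1 / 8) :
    VCP C ≤ VDP u w C + 8 * Real.sqrt N * supNormSphere C * (2 * ε + δ) + LC * δ := by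
  have he := (quad_eps hN hq).1
  have hδ0 : 0 ≤ δ := hδ ▸ disp_nonneg _
  have hs : 0 < Real.sqrt N := Real.sqrt_pos.mpr (by positivity)
  refine le_of_forall_pos_le_add fun t ht => ?_
  set D := 1 + 4 * Real.sqrt N * (2 * ε + δ) with hD
  have hD0 : 0 < D := by positivity
  obtain ⟨_, ⟨B, hB, rfl⟩, h⟩ := exists_lt_of_csInf_lt
      (s := quadSum u w '' DInf C (range u)) ⟨_, _, CInf_sub hq (bigBall_mem hC), rfl⟩
      (show sInf (quadSum u w '' DInf C (range u)) < VDP u w C + t / D by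
        rw [← VDP]; linarith [div_pos ht hD0])
  obtain ⟨K', h1, -, h3⟩ := disc_transfer hN hq hδ hC hsm (η := t / D) (by positivity)
    (K := ⟨⟨B, hB.2.2.1⟩, hB.1⟩) hB h.le rfl
  refine (VCP_le hN hC h1).trans (h3.trans (le_of_eq ?_))
  have : t / D * D = t := by field_simp
  rw [hD] at this ⊢
  linear_combination this

lemma C0_norm {N : ℕ} (hN : 2 ≤ N) {C : Euc N → ℝ} {LC : ℝ≥0}
    (hC : LipschitzOnWith LC C (Metric.sphere (0 : Euc N) 1)) {K : NonemptyCompacts (Euc N)}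
    (hK : K ∈ CG C 0) {b : Euc N} (hb : b ∈ (K : Set (Euc N))) :
    ‖b‖ ≤ 8 * Real.sqrt N * supNormSphere C := by
  have hs : 0 < Real.sqrt N := Real.sqrt_pos.mpr (by positivity)
  have h1 := cont_bound hN hC hK.1 hb
  have h2 := hK.2
  have h3 := VCP_le_sup hN hC
  have hM0 : 0 ≤ supNormSphere C := supNorm_nonneg C
  set s := Real.sqrt N
  have h4 : 9 / (32 * s) * ‖b‖ ≤ 9 / (32 * s) * (8 * s * supNormSphere C) := by
    have : 9 / (32 * s) * (8 * s * supNormSphere C) = 9 / 4 * supNormSphere C := by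
      field_simp; ring
    rw [this]; linarith
  exact le_of_mul_le_mul_left h4 (by positivity)

lemma C0_quad {N : ℕ} (hN : 2 ≤ N) {m : ℕ} {u : Fin m → Euc N} {w : Fin m → ℝ} {ε : ℝ}
    (hq : IsAccurateQuadrature u w ε) {C : Euc N → ℝ} {LC : ℝ≥0}
    (hC : LipschitzOnWith LC C (Metric.sphere (0 : Euc N) 1)) {K : NonemptyCompacts (Euc N)}
    (hK : K ∈ CG C 0) :
    quadSum u w (K : Set (Euc N)) ≤ VCP C + 2 * ε * (8 * Real.sqrt N * supNormSphere C) := by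
  have hM0 : 0 ≤ supNormSphere C := supNorm_nonneg C
  have := (abs_le.mp (quad_err hN hq K.nonempty K.isCompact (by positivity)
    (fun b hb => C0_norm hN hC hK hb))).1
  have := hK.2
  linarith
lemma tendsto_zero_of_ev {f : ℕ → ℝ} (h0 : ∀ n, 0 ≤ f n)
    (h : ∀ ρ > 0, ∀ᶠ n in atTop, f n ≤ ρ) : Tendsto f atTop (nhds 0) := by
  rw [Metric.tendsto_nhds]
  intro e he
  filter_upwards [h (e / 2) (by positivity)] with n hn
  rw [Real.dist_eq, sub_zero, abs_of_nonneg (h0 n)]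
  linarith

/-- for a sequence of `ε_n`-accurate quadratures with dispersions
`δ_n`, where `ε_n, δ_n ≤ 1/(10√N)` and `ε_n, δ_n → 0`, and
`γ_n = 16√N‖C‖_∞(2ε_n + δ_n) + L_C δ_n`, one has
(i) `d_{HH}(𝒟^{γ_n}_n, 𝒞^0) → 0`;
(ii) `max_{𝓑 ∈ 𝒟^0_n} min_{𝓑' ∈ 𝒞^0} d_H(𝓑,𝓑') → 0`;
(iii) if `𝒞^0` is a singleton, `d_{HH}(𝒟^0_n, 𝒞^0) → 0`. -/
theorem DGamma_tendsto_COpt {N : ℕ} (hN : 2 ≤ N)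
    (I : ℕ → ℕ) (u : ∀ n, Fin (I n) → Euc N) (w : ∀ n, Fin (I n) → ℝ)
    (ε δ : ℕ → ℝ)
    (hq : ∀ n, IsAccurateQuadrature (u n) (w n) (ε n))
    (hδ : ∀ n, δ n = dispersion (Set.range (u n)))
    (hεb : ∀ n, ε n ≤ 1 / (10 * Real.sqrt N)) (hδb : ∀ n, δ n ≤ 1 / (10 * Real.sqrt N))
    (hε0 : Filter.Tendsto ε Filter.atTop (nhds 0))
    (hδ0 : Filter.Tendsto δ Filter.atTop (nhds 0))
    (C : Euc N → ℝ) (LC : ℝ≥0) (hC : LipschitzOnWith LC C (Metric.sphere (0 : Euc N) 1))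
    (γ : ℕ → ℝ)
    (hγ : ∀ n, γ n = 16 * Real.sqrt N * supNormSphere C * (2 * ε n + δ n) + (LC : ℝ) * δ n) :
    Filter.Tendsto
        (fun n => Metric.hausdorffDist
          {K : NonemptyCompacts (Euc N) | (K : Set (Euc N)) ∈ DGamma (u n) (w n) C (γ n)}
          {K : NonemptyCompacts (Euc N) | (K : Set (Euc N)) ∈ CGamma C 0})
        Filter.atTop (nhds 0) ∧
      Filter.Tendsto
        (fun n => ⨆ K : {K : NonemptyCompacts (Euc N) // (K : Set (Euc N)) ∈ DGamma (u n) (w n) C 0},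
          Metric.infDist (K : NonemptyCompacts (Euc N))
            {K' : NonemptyCompacts (Euc N) | (K' : Set (Euc N)) ∈ CGamma C 0})
        Filter.atTop (nhds 0) ∧
      (∀ BCP : NonemptyCompacts (Euc N),
        {K : NonemptyCompacts (Euc N) | (K : Set (Euc N)) ∈ CGamma C 0} = {BCP} →
        Filter.Tendsto
          (fun n => Metric.hausdorffDist
            {K : NonemptyCompacts (Euc N) | (K : Set (Euc N)) ∈ DGamma (u n) (w n) C 0}
            {K : NonemptyCompacts (Euc N) | (K : Set (Euc N)) ∈ CGamma C 0})
          Filter.atTop (nhds 0)) := by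
  have hs : 0 < Real.sqrt N := Real.sqrt_pos.mpr (by positivity)
  have hM0 : 0 ≤ supNormSphere C := supNorm_nonneg C
  have he0 : ∀ n, 0 ≤ ε n := fun n => (quad_eps hN (hq n)).1
  have hδ0' : ∀ n, 0 ≤ δ n := fun n => hδ n ▸ disp_nonneg _
  have hγn : ∀ n, 0 ≤ γ n := fun n => by
    rw [hγ]
    have := he0 n
    have := hδ0' n
    positivity
  have hγ0 : Tendsto γ atTop (nhds 0) := by
    have : Tendsto (fun n => 16 * Real.sqrt N * supNormSphere C * (2 * ε n + δ n) + (LC : ℝ) * δ n)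
        atTop (nhds (16 * Real.sqrt N * supNormSphere C * (2 * 0 + 0) + (LC : ℝ) * 0)) :=
      (((hε0.const_mul 2).add hδ0).const_mul _).add (hδ0.const_mul _)
    rw [show γ = _ from funext hγ]
    simpa using this
  have hsm : ∀ᶠ n in atTop, ε n * (1 + 8 * Real.sqrt N) ≤ 1 / 8 := by
    have : Tendsto (fun n => ε n * (1 + 8 * Real.sqrt N)) atTop (nhds 0) := by
      simpa using hε0.mul_const (1 + 8 * Real.sqrt N)
    exact this.eventually_le_const (by norm_num)
  have hRt : Tendsto (fun n => 8 * Real.sqrt N * supNormSphere C + 4 * Real.sqrt N * γ n) atTop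
      (nhds (8 * Real.sqrt N * supNormSphere C + 4 * Real.sqrt N * 0)) :=
    (hγ0.const_mul _).const_add _
  have hat : Tendsto (fun n => δ n * ((8 * Real.sqrt N * supNormSphere C
      + 4 * Real.sqrt N * γ n) + LC)) atTop (nhds 0) := by
    simpa using hδ0.mul (hRt.add_const (LC : ℝ))
  have hΓt : Tendsto (fun n => 2 * ε n * (8 * Real.sqrt N * supNormSphere C) + γ n
      + 2 * ε n * (8 * Real.sqrt N * supNormSphere C + 4 * Real.sqrt N * γ n)
      + δ n * ((8 * Real.sqrt N * supNormSphere C + 4 * Real.sqrt N * γ n) + LC))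
      atTop (nhds 0) := by
    have := (((((hε0.const_mul 2).mul_const (8 * Real.sqrt N * supNormSphere C)).add hγ0).add
      ((hε0.const_mul 2).mul hRt)).add hat)
    simpa using this
  obtain ⟨K0, hK0⟩ := C0_nonempty hN hC
  have core : ∀ ρ > 0, ∀ᶠ n in atTop, ∀ K : NonemptyCompacts (Euc N),
      (K : Set (Euc N)) ∈ DGamma (u n) (w n) C (γ n) → infDist K (CG C 0) ≤ ρ := by
    intro ρ hρ
    obtain ⟨Γ, hΓ, hst⟩ := C_stable hN hC (half_pos hρ)
    filter_upwards [hsm, hat.eventually_le_const (half_pos hρ), hΓt.eventually_le_const hΓ]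
      with n h1 h2 h3 K hK
    obtain ⟨K', a1, a2, a3⟩ := disc_transfer hN (hq n) (hδ n) hC h1 (hγn n) hK.1
      (by linarith [hK.2]) rfl
    have hv : VDP (u n) (w n) C ≤ VCP C + 2 * ε n * (8 * Real.sqrt N * supNormSphere C) := by
      refine le_trans (csInf_le (VDP_bdd hN (hq n) hC ?_) ⟨_, CInf_sub (hq n) hK0.1, rfl⟩)
        (C0_quad hN (hq n) hC hK0)
      have b1 := small_aux hs h1
      have : 0 ≤ (1 + ε n) / (4 * Real.sqrt N) := by
        have := he0 n
        positivity
      linarith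
    have hK' : infDist K' (CG C 0) ≤ ρ / 2 := hst K' ⟨a1, by linarith⟩
    have := infDist_le_infDist_add_dist (s := CG C 0) (x := K) (y := K')
    linarith
  have core0 : ∀ ρ > 0, ∀ᶠ n in atTop, ∀ K : NonemptyCompacts (Euc N),
      (K : Set (Euc N)) ∈ DGamma (u n) (w n) C 0 → infDist K (CG C 0) ≤ ρ := by
    intro ρ hρ
    filter_upwards [core ρ hρ] with n hn K hK
    exact hn K ⟨hK.1, hK.2.trans (hγn n)⟩
  refine ⟨?_, ?_, ?_⟩
  · refine tendsto_zero_of_ev (fun n => hausdorffDist_nonneg) fun ρ hρ => ?_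
    filter_upwards [core ρ hρ, hsm] with n hn h1
    refine hausdorffDist_le_of_infDist hρ.le (fun K hK => hn K hK) fun K hK => ?_
    have hK' : K ∈ {K : NonemptyCompacts (Euc N) |
        (K : Set (Euc N)) ∈ DGamma (u n) (w n) C (γ n)} := by
      refine ⟨CInf_sub (hq n) hK.1, ?_⟩
      have b1 := C0_quad hN (hq n) hC hK
      have b2 := VCP_le_VDP hN (hq n) (hδ n) hC h1
      have b3 : 0 ≤ 8 * Real.sqrt N * supNormSphere C * δ n := by
        have := hδ0' n
        positivity
      rw [hγ]
      linarith
    rw [infDist_zero_of_mem hK']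
    exact hρ.le
  · refine tendsto_zero_of_ev (fun n => Real.iSup_nonneg fun K => infDist_nonneg) fun ρ hρ => ?_
    filter_upwards [core0 ρ hρ] with n hn
    exact Real.iSup_le (fun K => hn K K.2) hρ.le
  · intro BCP hB
    refine tendsto_zero_of_ev (fun n => hausdorffDist_nonneg) fun ρ hρ => ?_
    filter_upwards [core0 ρ hρ] with n hn
    refine hausdorffDist_le_of_infDist hρ.le (fun K hK => hn K hK) fun K hK => ?_
    rw [hB, mem_singleton_iff] at hK
    subst hK
    rcases Set.eq_empty_or_nonempty {K : NonemptyCompacts (Euc N) |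
        (K : Set (Euc N)) ∈ DGamma (u n) (w n) C 0} with h | ⟨K', hK'⟩
    · rw [h, infDist_empty]
      exact hρ.le
    · refine (infDist_le_dist_of_mem hK').trans ?_
      have := hn K' hK'
      rw [show CG C 0 = {K} from hB, infDist_singleton, dist_comm] at this
      exact this
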